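/- Let f be an expanding Lorenz map with critical point c admitting a primary n(k)-cycle z_0 < z_1 < ⋯ < z_{n-k-1} < c < z_{n-k} < ⋯ < z_{n-1}. Put u = f^{n-1}(0) and v = f^{n-1}(1) (these iterates are well defined, no earlier iterate of 0 or 1 hitting c). Then: (a) z_{n-k-1} ≤ u < c < v ≤ z_{n-k}; (b) for every x ∈ (u,c) ∪ (c,v) and every 0 ≤ i < n one has f^i(x) ≠ c, so f^n is continuous and strictly increasing on (u,c) and on (c,v); (c) lim_{x→c⁻} f^n(x) = v and lim_{x→c⁺} f^n(x) = u; (d) f^n((u,c)) ⊆ [u,v) and f^n((c,v)) ⊆ (u,v]. Consequently g = (f^n, f^n) is a renormalization of f with renormalization interval [u,v]. -/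

import Mathlib

open Set Filter Topology Function

/-- `f` is an expanding Lorenz map on `[a,b]` with critical point `c`:
continuous and strictly increasing on `[a,c)` and `(c,b]`, with
`lim_{x→c⁻} f(x) = b`, `lim_{x→c⁺} f(x) = a`, and differentiable with
derivative uniformly greater than `1` outside a finite set. -/
structure IsExpandingLorenzOn (f : ℝ → ℝ) (c a b : ℝ) : Prop where
  a_lt_c : a < c
  c_lt_b : c < b
  mapsTo : Set.MapsTo f (Set.Icc a b) (Set.Icc a b)
  mono_left : StrictMonoOn f (Set.Ico a c)
  mono_right : StrictMonoOn f (Set.Ioc c b)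
  cont_left : ContinuousOn f (Set.Ico a c)
  cont_right : ContinuousOn f (Set.Ioc c b)
  lim_left : Filter.Tendsto f (nhdsWithin c (Set.Iio c)) (nhds b)
  lim_right : Filter.Tendsto f (nhdsWithin c (Set.Ioi c)) (nhds a)
  expanding : ∃ F : Set ℝ, F.Finite ∧ ∃ lam : ℝ, 1 < lam ∧
    ∀ x ∈ Set.Icc a b \ F, ∃ d : ℝ, HasDerivWithinAt f d (Set.Icc a b) x ∧ lam ≤ d

/-- An expanding Lorenz map on `[0,1]` with critical point `c`. -/
def IsExpandingLorenz (f : ℝ → ℝ) (c : ℝ) : Prop := IsExpandingLorenzOn f c 0 1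

/-- A primary `n(k)`-cycle `z 0 < z 1 < ⋯ < z (n-k-1) < c < z (n-k) < ⋯ < z (n-1)`
for a Lorenz map `f` with critical point `c`. -/
structure IsPrimaryCycle (f : ℝ → ℝ) (c : ℝ) (n k : ℕ) (z : ℕ → ℝ) : Prop where
  k_pos : 0 < k
  k_lt_n : k < n
  coprime : Nat.Coprime n k
  mem : ∀ i < n, z i ∈ Set.Icc (0:ℝ) 1
  mono : ∀ i j : ℕ, i < j → j < n → z i < z j
  left_of_c : ∀ i < n - k, z i < c
  right_of_c : ∀ i : ℕ, n - k ≤ i → i < n → c < z i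
  step : ∀ i < n, f (z i) = z ((i + k) % n)
  le_f0 : z (k - 1) ≤ f 0
  f1_le : f 1 ≤ z k

/-- `g` is a renormalization `(f^l, f^r)` of the Lorenz map `f` on the
renormalization interval `[u,v]`: on `[u,c)` (resp. `(c,v]`) the map `g`
is given by `f^[l]` (resp. `f^[r]`), with values given by one-sided limits
at points where some earlier iterate hits `c`, and `g` is itself an
expanding Lorenz map on `[u,v]` with critical point `c`. -/
structure IsRenormalization (f : ℝ → ℝ) (c : ℝ) (l r : ℕ) (u v : ℝ) (g : ℝ → ℝ) : Prop where
  one_lt_l : 1 < l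
  one_lt_r : 1 < r
  u_nonneg : 0 ≤ u
  u_lt_c : u < c
  c_lt_v : c < v
  v_le_one : v ≤ 1
  proper : 0 < u ∨ v < 1
  eq_left : ∀ x ∈ Set.Ico u c, (∀ i < l, f^[i] x ≠ c) → g x = f^[l] x
  eq_right : ∀ x ∈ Set.Ioc c v, (∀ i < r, f^[i] x ≠ c) → g x = f^[r] x
  lim_left_pt : ∀ x ∈ Set.Ico u c,
    Filter.Tendsto (f^[l]) (nhdsWithin x (Set.Ioi x)) (nhds (g x))
  lim_right_pt : ∀ x ∈ Set.Ioc c v,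
    Filter.Tendsto (f^[r]) (nhdsWithin x (Set.Iio x)) (nhds (g x))
  lim_c_left : Filter.Tendsto (f^[l]) (nhdsWithin c (Set.Iio c)) (nhds v)
  lim_c_right : Filter.Tendsto (f^[r]) (nhdsWithin c (Set.Ioi c)) (nhds u)
  lorenz : IsExpandingLorenzOn g c u v

/-- The forward orbit of `x` enters the set `S` with a `c`-free prefix:
there is `n ≥ 0` with `f^[i] x ≠ c` for `0 ≤ i < n` and `f^[n] x ∈ S`. -/
def CFreeEnters (f : ℝ → ℝ) (c : ℝ) (S : Set ℝ) (x : ℝ) : Prop :=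
  ∃ n : ℕ, (∀ i < n, f^[i] x ≠ c) ∧ f^[n] x ∈ S

/-- `N(U) = min {n ≥ 0 : f^[n] z = c for some z ∈ U}`. -/
noncomputable def hitTime (f : ℝ → ℝ) (c : ℝ) (U : Set ℝ) : ℕ :=
  sInf {n : ℕ | ∃ z ∈ U, f^[n] z = c}

/-- `x ∈ [0,1]` is a `c`-free periodic point of `f` of (exact) period `p`. -/
def IsCFreePeriodic (f : ℝ → ℝ) (c x : ℝ) (p : ℕ) : Prop :=
  x ∈ Set.Icc (0:ℝ) 1 ∧ f^[p] x = x ∧ (∀ i : ℕ, 0 < i → i < p → f^[i] x ≠ x) ∧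
    ∀ i < p, f^[i] x ≠ c

/-- Topological transitivity of `f` as a map of `[0,1]`. -/
def LorenzTransitive (f : ℝ → ℝ) : Prop :=
  ∀ U V : Set ℝ, IsOpen U → IsOpen V →
    (U ∩ Set.Icc 0 1).Nonempty → (V ∩ Set.Icc 0 1).Nonempty →
    ∃ n : ℕ, (f^[n] '' (U ∩ Set.Icc 0 1) ∩ (V ∩ Set.Icc 0 1)).Nonempty

/-- `f` is locally eventually onto: every nonempty (relatively) open subset of `[0,1]`
contains open intervals mapped homeomorphically onto `(0,c)` and onto `(c,1)`
by suitable iterates of `f`. -/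
def LocallyEventuallyOnto (f : ℝ → ℝ) (c : ℝ) : Prop :=
  ∀ U : Set ℝ, IsOpen U → (U ∩ Set.Icc 0 1).Nonempty →
    (∃ a b : ℝ, a < b ∧ Set.Ioo a b ⊆ U ∩ Set.Icc 0 1 ∧ ∃ n : ℕ,
      ContinuousOn (f^[n]) (Set.Ioo a b) ∧ Set.InjOn (f^[n]) (Set.Ioo a b) ∧
        f^[n] '' Set.Ioo a b = Set.Ioo 0 c) ∧
    (∃ a b : ℝ, a < b ∧ Set.Ioo a b ⊆ U ∩ Set.Icc 0 1 ∧ ∃ n : ℕ,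
      ContinuousOn (f^[n]) (Set.Ioo a b) ∧ Set.InjOn (f^[n]) (Set.Ioo a b) ∧
        f^[n] '' Set.Ioo a b = Set.Ioo c 1)

/-- The generalized backward orbit of `x`: points joined to `x` by a chain
following `f`, where at the critical point `c` the chain may continue with
either `0` or `1`. -/
def GenBackwardOrbit (f : ℝ → ℝ) (c x : ℝ) : Set ℝ :=
  {y | y ∈ Set.Icc (0:ℝ) 1 ∧ ∃ (k : ℕ) (w : ℕ → ℝ), w 0 = y ∧ w k = x ∧
    ∀ i < k, (w i ≠ c → w (i + 1) = f (w i)) ∧ (w i = c → w (i + 1) = 0 ∨ w (i + 1) = 1)}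

/-- `h` stretches distances between points of `S` by a factor at least `r`, preserving order. -/
def ExpandsOn (r : ℝ) (h : ℝ → ℝ) (S : Set ℝ) : Prop :=
  ∀ x ∈ S, ∀ y ∈ S, x < y → r * (y - x) ≤ h y - h x

namespace ExpandsOn

variable {r s : ℝ} {g h : ℝ → ℝ} {S T : Set ℝ}

theorem mono (hh : ExpandsOn r h T) (hST : S ⊆ T) : ExpandsOn r h S :=
  fun x hx y hy hxy => hh x (hST hx) y (hST hy) hxy

theorem weaken (hh : ExpandsOn r h S) (hsr : s ≤ r) : ExpandsOn s h S := fun x hx y hy hxy =>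
  (mul_le_mul_of_nonneg_right hsr (sub_nonneg.2 hxy.le)).trans (hh x hx y hy hxy)

theorem strictMonoOn (hh : ExpandsOn r h S) (hr : 0 < r) : StrictMonoOn h S := by
  intro x hx y hy hxy
  have h1 := hh x hx y hy hxy
  have h2 := mul_pos hr (sub_pos.2 hxy)
  linarith

theorem comp (hg : ExpandsOn 1 g T) (hh : ExpandsOn r h S) (hr : 0 < r) (hST : MapsTo h S T) :
    ExpandsOn r (g ∘ h) S := by
  intro x hx y hy hxy
  have h1 := hg _ (hST hx) _ (hST hy) (hh.strictMonoOn hr hx hy hxy)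
  have h2 := hh x hx y hy hxy
  simp only [comp_apply]
  linarith

end ExpandsOn

/-- A mean value inequality allowing finitely many exceptional points. -/
theorem mul_sub_le_image_sub_of_hasDerivAt_off_finite {h : ℝ → ℝ} {r : ℝ} {F : Set ℝ}
    (hF : F.Finite) : ∀ x y : ℝ, x ≤ y → ContinuousOn h (Icc x y) →
      (∀ t ∈ Ioo x y \ F, ∃ d, HasDerivAt h d t ∧ r ≤ d) → r * (y - x) ≤ h y - h x := by
  induction F, hF using Set.Finite.induction_on with
  | empty =>
    intro x y hxy hc hd
    refine (convex_Icc x y).mul_sub_le_image_sub_of_le_deriv hc ?_ ?_ x (left_mem_Icc.2 hxy) y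
      (right_mem_Icc.2 hxy) hxy
    · intro t ht
      rw [interior_Icc] at ht
      obtain ⟨d, hd, -⟩ := hd t ⟨ht, by simp⟩
      exact hd.differentiableAt.differentiableWithinAt
    · intro t ht
      rw [interior_Icc] at ht
      obtain ⟨d, hd, hr⟩ := hd t ⟨ht, by simp⟩
      rwa [hd.deriv]
  | @insert p F _ _ ih =>
    intro x y hxy hc hd
    by_cases hp : p ∈ Ioo x y
    · have h1 := ih x p hp.1.le (hc.mono (Icc_subset_Icc_right hp.2.le)) fun t ht =>
        hd t ⟨⟨ht.1.1, ht.1.2.trans hp.2⟩, fun h => h.elim (fun h => ht.1.2.ne h) ht.2⟩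
      have h2 := ih p y hp.2.le (hc.mono (Icc_subset_Icc_left hp.1.le)) fun t ht =>
        hd t ⟨⟨hp.1.trans ht.1.1, ht.1.2⟩, fun h => h.elim (fun h => ht.1.1.ne' h) ht.2⟩
      linarith
    · exact ih x y hxy hc fun t ht =>
        hd t ⟨ht.1, fun h => h.elim (fun h => hp (h ▸ ht.1)) ht.2⟩

namespace IsExpandingLorenzOn

variable {f : ℝ → ℝ} {c a b : ℝ}

theorem exists_expandsOn (hf : IsExpandingLorenzOn f c a b) :
    ∃ r : ℝ, 1 < r ∧ ExpandsOn r f (Ico a c) ∧ ExpandsOn r f (Ioc c b) := by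
  obtain ⟨F, hF, r, hr, hd⟩ := hf.expanding
  have hac := hf.a_lt_c
  have hcb := hf.c_lt_b
  have key : ∀ x y : ℝ, a ≤ x → y ≤ b → ∀ t ∈ Ioo x y \ F, ∃ d, HasDerivAt f d t ∧ r ≤ d := by
    intro x y hx hy t ht
    have h1 : a < t := hx.trans_lt ht.1.1
    have h2 : t < b := ht.1.2.trans_le hy
    obtain ⟨d, hd, hrd⟩ := hd t ⟨⟨h1.le, h2.le⟩, ht.2⟩
    exact ⟨d, hd.hasDerivAt (Icc_mem_nhds h1 h2), hrd⟩
  refine ⟨r, hr, fun x hx y hy hxy => ?_, fun x hx y hy hxy => ?_⟩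
  · exact mul_sub_le_image_sub_of_hasDerivAt_off_finite hF x y hxy.le
      (hf.cont_left.mono fun t ht => ⟨hx.1.trans ht.1, ht.2.trans_lt hy.2⟩)
      (key x y hx.1 (hy.2.trans hcb).le)
  · exact mul_sub_le_image_sub_of_hasDerivAt_off_finite hF x y hxy.le
      (hf.cont_right.mono fun t ht => ⟨hx.1.trans_le ht.1, ht.2.trans hy.2⟩)
      (key x y (hac.trans hx.1).le hy.2)

theorem lt_right_of_mem_Ico (hf : IsExpandingLorenzOn f c a b) {x : ℝ} (hx : x ∈ Ico a c) :
    f x < b := by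
  obtain ⟨y, hxy, hyc⟩ := exists_between hx.2
  have hy : y ∈ Ico a c := ⟨hx.1.trans hxy.le, hyc⟩
  exact (hf.mono_left hx hy hxy).trans_le
    (hf.mapsTo ⟨hy.1, (hyc.trans hf.c_lt_b).le⟩).2

theorem left_lt_of_mem_Ioc (hf : IsExpandingLorenzOn f c a b) {x : ℝ} (hx : x ∈ Ioc c b) :
    a < f x := by
  obtain ⟨y, hcy, hyx⟩ := exists_between hx.1
  have hy : y ∈ Ioc c b := ⟨hcy, hyx.le.trans hx.2⟩
  exact (hf.mapsTo ⟨(hf.a_lt_c.trans hcy).le, hy.2⟩).1.trans_lt (hf.mono_right hy hx hyx)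

theorem finite_preimage (hf : IsExpandingLorenzOn f c a b) {S : Set ℝ} (hS : S.Finite) :
    {x | x ∈ Icc a b ∧ f x ∈ S}.Finite := by
  have h1 : (Ico a c ∩ f ⁻¹' S).Finite :=
    Set.Finite.of_finite_image (hS.subset (by rintro _ ⟨x, hx, rfl⟩; exact hx.2))
      (hf.mono_left.injOn.mono inter_subset_left)
  have h2 : (Ioc c b ∩ f ⁻¹' S).Finite :=
    Set.Finite.of_finite_image (hS.subset (by rintro _ ⟨x, hx, rfl⟩; exact hx.2))
      (hf.mono_right.injOn.mono inter_subset_left)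
  refine ((h1.union h2).union (finite_singleton c)).subset ?_
  rintro x ⟨hx, hxS⟩
  rcases lt_trichotomy x c with h | h | h
  · exact .inl (.inl ⟨⟨hx.1, h⟩, hxS⟩)
  · exact .inr h
  · exact .inl (.inr ⟨⟨h, hx.2⟩, hxS⟩)

theorem finite_preimage_iterate (hf : IsExpandingLorenzOn f c a b) {S : Set ℝ} (hS : S.Finite)
    (i : ℕ) : {x | x ∈ Icc a b ∧ f^[i] x ∈ S}.Finite := by
  induction i with
  | zero => exact hS.subset fun x hx => hx.2
  | succ i ih =>
    exact (hf.finite_preimage ih).subset fun x hx => ⟨hx.1, hf.mapsTo hx.1, hx.2⟩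

/-- Every positive iterate is expanding outside a finite set. -/
theorem iterate_expanding (hf : IsExpandingLorenzOn f c a b) {n : ℕ} (hn : 0 < n) :
    ∃ F : Set ℝ, F.Finite ∧ ∃ r : ℝ, 1 < r ∧
      ∀ x ∈ Icc a b \ F, ∃ d : ℝ, HasDerivWithinAt (f^[n]) d (Icc a b) x ∧ r ≤ d := by
  obtain ⟨F, hF, r, hr, hd⟩ := hf.expanding
  have key : ∀ m : ℕ, ∀ x ∈ Icc a b, (∀ i < m, f^[i] x ∉ F) →
      ∃ d : ℝ, HasDerivWithinAt (f^[m]) d (Icc a b) x ∧ r ^ m ≤ d := by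
    intro m
    induction m with
    | zero => exact fun x _ _ => ⟨1, hasDerivWithinAt_id x _, by simp⟩
    | succ m ih =>
      intro x hx hxF
      obtain ⟨d, hd', hrd⟩ := ih x hx fun i hi => hxF i (hi.trans m.lt_succ_self)
      obtain ⟨e, he, hre⟩ := hd (f^[m] x) ⟨hf.mapsTo.iterate m hx, hxF m m.lt_succ_self⟩
      refine ⟨e * d, ?_, ?_⟩
      · rw [iterate_succ']
        exact he.comp x hd' (hf.mapsTo.iterate m)
      · rw [pow_succ']
        exact mul_le_mul hre hrd (by positivity) (by linarith)
  refine ⟨⋃ i ∈ Finset.range n, {x | x ∈ Icc a b ∧ f^[i] x ∈ F},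
    (Finset.range n).finite_toSet.biUnion fun i _ => hf.finite_preimage_iterate hF i,
    r ^ n, one_lt_pow₀ hr hn.ne', fun x hx => key n x hx.1 fun i hi hxi => hx.2 ?_⟩
  simp only [mem_iUnion, Finset.mem_range]
  exact ⟨i, hi, hx.1, hxi⟩

end IsExpandingLorenzOn

namespace IsPrimaryCycle

variable {f : ℝ → ℝ} {c : ℝ} {n k : ℕ} {z : ℕ → ℝ}

theorem monotone_le (hz : IsPrimaryCycle f c n k z) {i j : ℕ} (hij : i ≤ j) (hj : j < n) :
    z i ≤ z j := by
  rcases hij.eq_or_lt with rfl | h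
  · exact le_rfl
  · exact (hz.mono i j h hj).le

theorem step_of_lt (hz : IsPrimaryCycle f c n k z) {j : ℕ} (hj : j + k < n) :
    f (z j) = z (j + k) := by
  rw [hz.step j (by omega), Nat.mod_eq_of_lt hj]

theorem step_of_le (hz : IsPrimaryCycle f c n k z) {j i : ℕ} (hj : j < n) (hi : j + k = i + n) :
    f (z j) = z i := by
  have hk := hz.k_lt_n
  rw [hz.step j hj, hi, Nat.add_mod_right, Nat.mod_eq_of_lt (by omega)]

theorem gap_step (hz : IsPrimaryCycle f c n k z) {j : ℕ} (h1 : 1 ≤ j) (hj : j < n)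
    (hjk : j ≠ n - k) :
    f (z (j - 1)) = z ((j + k) % n - 1) ∧ f (z j) = z ((j + k) % n) ∧
      (Icc (z (j - 1)) (z j) ⊆ Ico 0 c ∨ Icc (z (j - 1)) (z j) ⊆ Ioc c 1) := by
  have hk := hz.k_lt_n
  refine ⟨?_, hz.step j hj, ?_⟩
  · rcases lt_or_ge (j + k) n with h | h
    · rw [hz.step_of_lt (by omega), Nat.mod_eq_of_lt h]
      congr 1
      omega
    · have : (j + k) % n = j + k - n := by
        rw [Nat.mod_eq_sub_mod h, Nat.mod_eq_of_lt (by omega)]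
      rw [this]
      exact hz.step_of_le (by omega) (by omega)
  · rcases lt_or_gt_of_ne hjk with h | h
    · exact .inl fun x hx =>
        ⟨(hz.mem _ (by omega)).1.trans hx.1, hx.2.trans_lt (hz.left_of_c j h)⟩
    · exact .inr fun x hx =>
        ⟨(hz.right_of_c (j - 1) (by omega) (by omega)).trans_le hx.1, hx.2.trans (hz.mem j hj).2⟩

theorem mul_mod_ne_zero (hz : IsPrimaryCycle f c n k z) {m : ℕ} (hm : 0 < m) (hmn : m < n) :
    m * k % n ≠ 0 := fun h =>
  Nat.not_dvd_of_pos_of_lt hm hmn (hz.coprime.dvd_of_dvd_mul_right (Nat.dvd_of_mod_eq_zero h))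

theorem mul_mod_ne_sub (hz : IsPrimaryCycle f c n k z) {m : ℕ} (hmn : m + 1 < n) :
    m * k % n ≠ n - k := by
  have hk := hz.k_lt_n
  intro h
  apply hz.mul_mod_ne_zero (Nat.succ_pos m) hmn
  rw [Nat.succ_mul, ← Nat.mod_add_mod, h, Nat.sub_add_cancel hk.le, Nat.mod_self]

theorem pred_mul_mod (hz : IsPrimaryCycle f c n k z) : (n - 1) * k % n = n - k := by
  have hk := hz.k_lt_n
  have hk0 := hz.k_pos
  have h : (n - 1) * k = (n - k) + n * (k - 1) := by
    zify [hk.le, show 1 ≤ n by omega, show 1 ≤ k from hk0]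
    ring
  rw [h, Nat.add_mul_mod_self_left, Nat.mod_eq_of_lt (by omega)]

/-- The iterates of `f` along the gap `[z (k-1), z k]`, up to its arrival at the gap around `c`. -/
theorem gap_iterate (hz : IsPrimaryCycle f c n k z) (hf : IsExpandingLorenz f c) (m : ℕ)
    (hm : m + 2 ≤ n) :
    f^[m] (z (k - 1)) = z ((m + 1) * k % n - 1) ∧ f^[m] (z k) = z ((m + 1) * k % n) ∧
      ExpandsOn 1 (f^[m]) (Icc (z (k - 1)) (z k)) ∧
      ContinuousOn (f^[m]) (Icc (z (k - 1)) (z k)) ∧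
      MapsTo (f^[m]) (Icc (z (k - 1)) (z k))
        (Icc (z ((m + 1) * k % n - 1)) (z ((m + 1) * k % n))) := by
  have hk := hz.k_lt_n
  induction m with
  | zero =>
    simp only [zero_add, one_mul, Nat.mod_eq_of_lt hk, iterate_zero]
    exact ⟨rfl, rfl, fun x _ y _ _ => by simp, continuousOn_id, mapsTo_id _⟩
  | succ m ih =>
    obtain ⟨hl, hr, hE, hC, hM⟩ := ih (by omega)
    have h0 := hz.mul_mod_ne_zero m.succ_pos (by omega)
    obtain ⟨sl, sr, hS⟩ := hz.gap_step (Nat.one_le_iff_ne_zero.2 h0)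
      (Nat.mod_lt _ (by omega)) (hz.mul_mod_ne_sub (m := m + 1) (by omega))
    rw [Nat.mod_add_mod, ← Nat.succ_mul] at sl sr
    obtain ⟨r, hr1, hEl, hEr⟩ := hf.exists_expandsOn
    have hE1 : ExpandsOn 1 f (Icc (z ((m + 1) * k % n - 1)) (z ((m + 1) * k % n))) :=
      hS.elim (fun h => (hEl.mono h).weaken hr1.le) (fun h => (hEr.mono h).weaken hr1.le)
    have hC1 : ContinuousOn f (Icc (z ((m + 1) * k % n - 1)) (z ((m + 1) * k % n))) :=
      hS.elim (fun h => hf.cont_left.mono h) (fun h => hf.cont_right.mono h)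
    have hM1 := (hE1.strictMonoOn one_pos).monotoneOn.mapsTo_Icc
    rw [Nat.succ_eq_add_one] at sl sr
    rw [sl, sr] at hM1
    rw [iterate_succ']
    exact ⟨by rw [comp_apply, hl, sl], by rw [comp_apply, hr, sr], hE1.comp hE one_pos hM,
      hC1.comp hC hM, hM1.comp hM⟩

theorem gap_iterate_ne (hz : IsPrimaryCycle f c n k z) (hf : IsExpandingLorenz f c) {m : ℕ}
    (hm : m + 2 < n) {x : ℝ} (hx : x ∈ Icc (z (k - 1)) (z k)) : f^[m] x ≠ c := by
  have hM := (hz.gap_iterate hf m hm.le).2.2.2.2 hx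
  have h0 := hz.mul_mod_ne_zero m.succ_pos (by omega)
  obtain ⟨-, -, hS | hS⟩ := hz.gap_step (Nat.one_le_iff_ne_zero.2 h0)
      (Nat.mod_lt _ (by omega)) (hz.mul_mod_ne_sub (m := m + 1) (by omega))
  · exact (hS hM).2.ne
  · exact (hS hM).1.ne'

theorem gap_iterate_last (hz : IsPrimaryCycle f c n k z) (hf : IsExpandingLorenz f c) :
    f^[n - 2] (z (k - 1)) = z (n - k - 1) ∧ f^[n - 2] (z k) = z (n - k) ∧
      ExpandsOn 1 (f^[n - 2]) (Icc (z (k - 1)) (z k)) ∧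
      ContinuousOn (f^[n - 2]) (Icc (z (k - 1)) (z k)) ∧
      MapsTo (f^[n - 2]) (Icc (z (k - 1)) (z k)) (Icc (z (n - k - 1)) (z (n - k))) := by
  have hk := hz.k_lt_n
  have hk0 := hz.k_pos
  have h := hz.gap_iterate hf (n - 2) (by omega)
  rwa [show n - 2 + 1 = n - 1 by omega, hz.pred_mul_mod] at h

theorem iterate_pred_eq (hz : IsPrimaryCycle f c n k z) (x : ℝ) :
    f^[n - 1] x = f^[n - 2] (f x) := by
  have hk := hz.k_lt_n
  have hk0 := hz.k_pos
  rw [← iterate_succ_apply, show (n - 2).succ = n - 1 by omega]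

theorem iterate_eq (hz : IsPrimaryCycle f c n k z) : f^[n] = f^[n - 2] ∘ f ∘ f := by
  have hk := hz.k_lt_n
  have hk0 := hz.k_pos
  rw [← comp_assoc, ← iterate_succ, ← iterate_succ, show (n - 2).succ.succ = n by omega]

theorem step_first (hz : IsPrimaryCycle f c n k z) : f (z 0) = z k := by
  simpa using hz.step_of_lt (j := 0) (by simpa using hz.k_lt_n)

theorem step_last (hz : IsPrimaryCycle f c n k z) : f (z (n - 1)) = z (k - 1) := by
  have hk := hz.k_lt_n
  have hk0 := hz.k_pos
  exact hz.step_of_le (by omega) (by omega)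

theorem step_left (hz : IsPrimaryCycle f c n k z) : f (z (n - k - 1)) = z (n - 1) := by
  have hk := hz.k_lt_n
  rw [hz.step_of_lt (by omega)]
  congr 1
  omega

theorem step_right (hz : IsPrimaryCycle f c n k z) : f (z (n - k)) = z 0 := by
  have hk := hz.k_lt_n
  have hk0 := hz.k_pos
  exact hz.step_of_le (by omega) (by omega)

theorem left_mem (hz : IsPrimaryCycle f c n k z) : z (n - k - 1) ∈ Ico 0 c := by
  have hk := hz.k_lt_n
  exact ⟨(hz.mem _ (by omega)).1, hz.left_of_c _ (by omega)⟩

theorem right_mem (hz : IsPrimaryCycle f c n k z) : z (n - k) ∈ Ioc c 1 := by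
  have hk := hz.k_lt_n
  have hk0 := hz.k_pos
  exact ⟨hz.right_of_c _ le_rfl (by omega), (hz.mem _ (by omega)).2⟩

theorem first_mem (hz : IsPrimaryCycle f c n k z) : z 0 ∈ Ico 0 c := by
  have hk := hz.k_lt_n
  exact ⟨(hz.mem _ (by omega)).1, hz.left_of_c _ (by omega)⟩

theorem last_mem (hz : IsPrimaryCycle f c n k z) : z (n - 1) ∈ Ioc c 1 := by
  have hk := hz.k_lt_n
  have hk0 := hz.k_pos
  exact ⟨hz.right_of_c _ (by omega) (by omega), (hz.mem _ (by omega)).2⟩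

theorem map_zero_mem (hz : IsPrimaryCycle f c n k z) (hf : IsExpandingLorenz f c) :
    f 0 ∈ Icc (z (k - 1)) (z k) := by
  refine ⟨hz.le_f0, ?_⟩
  rw [← hz.step_first]
  exact hf.mono_left.monotoneOn ⟨le_rfl, hf.a_lt_c⟩ hz.first_mem hz.first_mem.1

theorem map_one_mem (hz : IsPrimaryCycle f c n k z) (hf : IsExpandingLorenz f c) :
    f 1 ∈ Icc (z (k - 1)) (z k) := by
  refine ⟨?_, hz.f1_le⟩
  rw [← hz.step_last]
  exact hf.mono_right.monotoneOn hz.last_mem ⟨hf.c_lt_b, le_rfl⟩ hz.last_mem.2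

theorem mapsTo_left (hz : IsPrimaryCycle f c n k z) (hf : IsExpandingLorenz f c) :
    MapsTo f (Ico (z (n - k - 1)) c) (Icc (z (n - 1)) 1) := by
  intro x hx
  have hx' : x ∈ Ico 0 c := ⟨hz.left_mem.1.trans hx.1, hx.2⟩
  refine ⟨?_, (hf.lt_right_of_mem_Ico hx').le⟩
  rw [← hz.step_left]
  exact hf.mono_left.monotoneOn hz.left_mem hx' hx.1

theorem mapsTo_right (hz : IsPrimaryCycle f c n k z) (hf : IsExpandingLorenz f c) :
    MapsTo f (Ioc c (z (n - k))) (Icc 0 (z 0)) := by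
  intro x hx
  have hx' : x ∈ Ioc c 1 := ⟨hx.1, hx.2.trans hz.right_mem.2⟩
  refine ⟨(hf.left_lt_of_mem_Ioc hx').le, ?_⟩
  rw [← hz.step_right]
  exact hf.mono_right.monotoneOn hx' hz.right_mem hx.2

theorem Icc_last_subset (hz : IsPrimaryCycle f c n k z) : Icc (z (n - 1)) 1 ⊆ Ioc c 1 :=
  fun _ hx => ⟨hz.last_mem.1.trans_le hx.1, hx.2⟩

theorem Icc_first_subset (hz : IsPrimaryCycle f c n k z) : Icc 0 (z 0) ⊆ Ico 0 c :=
  fun _ hx => ⟨hx.1, hx.2.trans_lt hz.first_mem.2⟩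

theorem Ico_left_subset (hz : IsPrimaryCycle f c n k z) : Ico (z (n - k - 1)) c ⊆ Ico 0 c :=
  Ico_subset_Ico_left hz.left_mem.1

theorem Ioc_right_subset (hz : IsPrimaryCycle f c n k z) : Ioc c (z (n - k)) ⊆ Ioc c 1 :=
  Ioc_subset_Ioc_right hz.right_mem.2

theorem mapsTo_Icc_last (hz : IsPrimaryCycle f c n k z) (hf : IsExpandingLorenz f c) :
    MapsTo f (Icc (z (n - 1)) 1) (Icc (z (k - 1)) (z k)) := by
  have h := (hf.mono_right.mono hz.Icc_last_subset).monotoneOn.mapsTo_Icc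
  rw [hz.step_last] at h
  exact h.mono_right (Icc_subset_Icc_right hz.f1_le)

theorem mapsTo_Icc_first (hz : IsPrimaryCycle f c n k z) (hf : IsExpandingLorenz f c) :
    MapsTo f (Icc 0 (z 0)) (Icc (z (k - 1)) (z k)) := by
  have h := (hf.mono_left.mono hz.Icc_first_subset).monotoneOn.mapsTo_Icc
  rw [hz.step_first] at h
  exact h.mono_right (Icc_subset_Icc_left hz.le_f0)

theorem mem_gap_left (hz : IsPrimaryCycle f c n k z) (hf : IsExpandingLorenz f c) :
    f^[n - 1] 0 ∈ Icc (z (n - k - 1)) (z (n - k)) := by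
  rw [hz.iterate_pred_eq]
  exact (hz.gap_iterate_last hf).2.2.2.2 (hz.map_zero_mem hf)

theorem mem_gap_right (hz : IsPrimaryCycle f c n k z) (hf : IsExpandingLorenz f c) :
    f^[n - 1] 1 ∈ Icc (z (n - k - 1)) (z (n - k)) := by
  rw [hz.iterate_pred_eq]
  exact (hz.gap_iterate_last hf).2.2.2.2 (hz.map_one_mem hf)

theorem iterate_ne_of_mem (hz : IsPrimaryCycle f c n k z) (hf : IsExpandingLorenz f c) {x : ℝ}
    (hx : x ∈ Ico (z (n - k - 1)) c ∪ Ioc c (z (n - k))) {i : ℕ} (hi : i < n) : f^[i] x ≠ c := by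
  rcases i with _ | _ | i
  · exact hx.elim (fun h => h.2.ne) (fun h => h.1.ne')
  · exact hx.elim (fun h => (hz.Icc_last_subset (hz.mapsTo_left hf h)).1.ne')
      (fun h => (hz.Icc_first_subset (hz.mapsTo_right hf h)).2.ne)
  · exact hz.gap_iterate_ne hf hi <|
      hx.elim (fun h => hz.mapsTo_Icc_last hf (hz.mapsTo_left hf h))
        (fun h => hz.mapsTo_Icc_first hf (hz.mapsTo_right hf h))

theorem iterate_zero_ne (hz : IsPrimaryCycle f c n k z) (hf : IsExpandingLorenz f c) {i : ℕ}
    (hi : i < n - 1) : f^[i] 0 ≠ c := by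
  rcases i with _ | i
  · exact hf.a_lt_c.ne
  · rw [iterate_succ_apply]
    exact hz.gap_iterate_ne hf (by omega) (hz.map_zero_mem hf)

theorem iterate_one_ne (hz : IsPrimaryCycle f c n k z) (hf : IsExpandingLorenz f c) {i : ℕ}
    (hi : i < n - 1) : f^[i] 1 ≠ c := by
  rcases i with _ | i
  · exact hf.c_lt_b.ne'
  · rw [iterate_succ_apply]
    exact hz.gap_iterate_ne hf (by omega) (hz.map_one_mem hf)

theorem exists_expandsOn_iterate (hz : IsPrimaryCycle f c n k z) (hf : IsExpandingLorenz f c) :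
    ∃ r : ℝ, 1 < r ∧ ExpandsOn r (f^[n]) (Ico (z (n - k - 1)) c) ∧
      ExpandsOn r (f^[n]) (Ioc c (z (n - k))) := by
  obtain ⟨r, hr, hl, hr'⟩ := hf.exists_expandsOn
  obtain ⟨-, -, hE, -, -⟩ := hz.gap_iterate_last hf
  have h0 : 0 < r := by linarith
  rw [hz.iterate_eq]
  exact ⟨r, hr,
    hE.comp (((hr'.mono hz.Icc_last_subset).weaken hr.le).comp (hl.mono hz.Ico_left_subset) h0
      (hz.mapsTo_left hf)) h0 ((hz.mapsTo_Icc_last hf).comp (hz.mapsTo_left hf)),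
    hE.comp (((hl.mono hz.Icc_first_subset).weaken hr.le).comp (hr'.mono hz.Ioc_right_subset) h0
      (hz.mapsTo_right hf)) h0 ((hz.mapsTo_Icc_first hf).comp (hz.mapsTo_right hf))⟩

theorem continuousOn_left (hz : IsPrimaryCycle f c n k z) (hf : IsExpandingLorenz f c) :
    ContinuousOn (f^[n]) (Ico (z (n - k - 1)) c) := by
  rw [hz.iterate_eq]
  exact (hz.gap_iterate_last hf).2.2.2.1.comp
    ((hf.cont_right.mono hz.Icc_last_subset).comp (hf.cont_left.mono hz.Ico_left_subset)
      (hz.mapsTo_left hf)) ((hz.mapsTo_Icc_last hf).comp (hz.mapsTo_left hf))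

theorem continuousOn_right (hz : IsPrimaryCycle f c n k z) (hf : IsExpandingLorenz f c) :
    ContinuousOn (f^[n]) (Ioc c (z (n - k))) := by
  rw [hz.iterate_eq]
  exact (hz.gap_iterate_last hf).2.2.2.1.comp
    ((hf.cont_left.mono hz.Icc_first_subset).comp (hf.cont_right.mono hz.Ioc_right_subset)
      (hz.mapsTo_right hf)) ((hz.mapsTo_Icc_first hf).comp (hz.mapsTo_right hf))

theorem tendsto_left (hz : IsPrimaryCycle f c n k z) (hf : IsExpandingLorenz f c) :
    Tendsto (f^[n]) (𝓝[<] c) (𝓝 (f^[n - 1] 1)) := by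
  rw [hz.iterate_eq, hz.iterate_pred_eq, ← nhdsWithin_Ico_eq_nhdsLT hz.left_mem.2]
  have hC : ContinuousOn (f^[n - 2] ∘ f) (Icc (z (n - 1)) 1) :=
    (hz.gap_iterate_last hf).2.2.2.1.comp (hf.cont_right.mono hz.Icc_last_subset)
      (hz.mapsTo_Icc_last hf)
  refine (hC 1 ⟨hz.last_mem.2, le_rfl⟩).tendsto.comp (tendsto_nhdsWithin_iff.2 ⟨?_, ?_⟩)
  · exact hf.lim_left.mono_left (nhdsWithin_mono _ fun x hx => hx.2)
  · exact eventually_mem_nhdsWithin.mono fun x hx => hz.mapsTo_left hf hx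

theorem tendsto_right (hz : IsPrimaryCycle f c n k z) (hf : IsExpandingLorenz f c) :
    Tendsto (f^[n]) (𝓝[>] c) (𝓝 (f^[n - 1] 0)) := by
  rw [hz.iterate_eq, hz.iterate_pred_eq, ← nhdsWithin_Ioc_eq_nhdsGT hz.right_mem.1]
  have hC : ContinuousOn (f^[n - 2] ∘ f) (Icc 0 (z 0)) :=
    (hz.gap_iterate_last hf).2.2.2.1.comp (hf.cont_left.mono hz.Icc_first_subset)
      (hz.mapsTo_Icc_first hf)
  refine (hC 0 ⟨le_rfl, hz.first_mem.1⟩).tendsto.comp (tendsto_nhdsWithin_iff.2 ⟨?_, ?_⟩)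
  · exact hf.lim_right.mono_left (nhdsWithin_mono _ fun x hx => hx.1)
  · exact eventually_mem_nhdsWithin.mono fun x hx => hz.mapsTo_right hf hx

theorem iterate_left_fixed (hz : IsPrimaryCycle f c n k z) (hf : IsExpandingLorenz f c) :
    f^[n] (z (n - k - 1)) = z (n - k - 1) := by
  rw [hz.iterate_eq, comp_apply, comp_apply, hz.step_left, hz.step_last]
  exact (hz.gap_iterate_last hf).1

theorem iterate_right_fixed (hz : IsPrimaryCycle f c n k z) (hf : IsExpandingLorenz f c) :
    f^[n] (z (n - k)) = z (n - k) := by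
  rw [hz.iterate_eq, comp_apply, comp_apply, hz.step_right, hz.step_first]
  exact (hz.gap_iterate_last hf).2.1

theorem le_iterate_of_mem_left (hz : IsPrimaryCycle f c n k z) (hf : IsExpandingLorenz f c)
    {x : ℝ} (hx : x ∈ Ico (z (n - k - 1)) c) : x ≤ f^[n] x := by
  obtain ⟨r, hr, hE, -⟩ := hz.exists_expandsOn_iterate hf
  rcases hx.1.eq_or_lt with h | h
  · rw [← h, hz.iterate_left_fixed hf]
  · have := hE.weaken hr.le _ ⟨le_rfl, hz.left_mem.2⟩ x hx h
    rw [hz.iterate_left_fixed hf] at this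
    linarith

theorem iterate_le_of_mem_right (hz : IsPrimaryCycle f c n k z) (hf : IsExpandingLorenz f c)
    {x : ℝ} (hx : x ∈ Ioc c (z (n - k))) : f^[n] x ≤ x := by
  obtain ⟨r, hr, -, hE⟩ := hz.exists_expandsOn_iterate hf
  rcases hx.2.eq_or_lt with h | h
  · rw [h, hz.iterate_right_fixed hf]
  · have := hE.weaken hr.le x hx _ ⟨hz.right_mem.1, le_rfl⟩ h
    rw [hz.iterate_right_fixed hf] at this
    linarith

theorem iterate_lt_of_mem_left (hz : IsPrimaryCycle f c n k z) (hf : IsExpandingLorenz f c)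
    {x : ℝ} (hx : x ∈ Ico (z (n - k - 1)) c) : f^[n] x < f^[n - 1] 1 := by
  rw [hz.iterate_eq, hz.iterate_pred_eq]
  have hx' := hz.mapsTo_left hf hx
  refine (hz.gap_iterate_last hf).2.2.1.strictMonoOn one_pos (hz.mapsTo_Icc_last hf hx')
    (hz.map_one_mem hf) ?_
  exact hf.mono_right (hz.Icc_last_subset hx') ⟨hf.c_lt_b, le_rfl⟩
    (hf.lt_right_of_mem_Ico (hz.Ico_left_subset hx))

theorem lt_iterate_of_mem_right (hz : IsPrimaryCycle f c n k z) (hf : IsExpandingLorenz f c)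
    {x : ℝ} (hx : x ∈ Ioc c (z (n - k))) : f^[n - 1] 0 < f^[n] x := by
  rw [hz.iterate_eq, hz.iterate_pred_eq]
  have hx' := hz.mapsTo_right hf hx
  refine (hz.gap_iterate_last hf).2.2.1.strictMonoOn one_pos (hz.map_zero_mem hf)
    (hz.mapsTo_Icc_first hf hx') ?_
  exact hf.mono_left ⟨le_rfl, hf.a_lt_c⟩ (hz.Icc_first_subset hx')
    (hf.left_lt_of_mem_Ioc (hz.Ioc_right_subset hx))

theorem lt_iterate_one (hz : IsPrimaryCycle f c n k z) (hf : IsExpandingLorenz f c) :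
    c < f^[n - 1] 1 := by
  obtain ⟨r, hr, hE, -⟩ := hz.exists_expandsOn_iterate hf
  have hc := hz.left_mem.2
  have hlim : Tendsto (fun x : ℝ => r * (x - z (n - k - 1))) (𝓝[<] c)
      (𝓝 (r * (c - z (n - k - 1)))) :=
    ((continuous_const.mul (continuous_id.sub continuous_const)).tendsto c).mono_left
      nhdsWithin_le_nhds
  have h := le_of_tendsto_of_tendsto hlim ((hz.tendsto_left hf).sub_const (z (n - k - 1))) <| by
    filter_upwards [Ioo_mem_nhdsLT hc] with x hx
    have := hE _ ⟨le_rfl, hc⟩ x ⟨hx.1.le, hx.2⟩ hx.1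
    rwa [hz.iterate_left_fixed hf] at this
  nlinarith

theorem iterate_zero_lt (hz : IsPrimaryCycle f c n k z) (hf : IsExpandingLorenz f c) :
    f^[n - 1] 0 < c := by
  obtain ⟨r, hr, -, hE⟩ := hz.exists_expandsOn_iterate hf
  have hc := hz.right_mem.1
  have hlim : Tendsto (fun x : ℝ => r * (z (n - k) - x)) (𝓝[>] c)
      (𝓝 (r * (z (n - k) - c))) :=
    ((continuous_const.mul (continuous_const.sub continuous_id)).tendsto c).mono_left
      nhdsWithin_le_nhds
  have h := le_of_tendsto_of_tendsto hlim ((hz.tendsto_right hf).const_sub (z (n - k))) <| by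
    filter_upwards [Ioo_mem_nhdsGT hc] with x hx
    have := hE x ⟨hx.1, hx.2.le⟩ _ ⟨hc, le_rfl⟩ hx.2
    rwa [hz.iterate_right_fixed hf] at this
  nlinarith

theorem right_lt_one (hz : IsPrimaryCycle f c n k z) (hf : IsExpandingLorenz f c) :
    z (n - k) < 1 := by
  have hk := hz.k_lt_n
  have hk0 := hz.k_pos
  refine (hz.monotone_le (j := n - 1) (by omega) (by omega)).trans_lt ?_
  rw [← hz.step_left]
  exact hf.lt_right_of_mem_Ico hz.left_mem

/-- The return map `f^[n]` with its value at `c` set to `u = f^[n-1] 0` is a renormalization. -/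
theorem isRenormalization (hz : IsPrimaryCycle f c n k z) (hf : IsExpandingLorenz f c) :
    IsRenormalization f c n n (f^[n - 1] 0) (f^[n - 1] 1)
      (update (f^[n]) c (f^[n - 1] 0)) := by
  have hk := hz.k_lt_n
  have hk0 := hz.k_pos
  have huc := hz.iterate_zero_lt hf
  have hcv := hz.lt_iterate_one hf
  have hu := (hz.mem_gap_left hf).1
  have hv := (hz.mem_gap_right hf).2
  have hv1 := hv.trans_lt (hz.right_lt_one hf)
  have hu0 := hz.left_mem.1.trans hu
  set u := f^[n - 1] 0
  set v := f^[n - 1] 1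
  have hL : Ico u c ⊆ Ico (z (n - k - 1)) c := Ico_subset_Ico_left hu
  have hR : Ioc c v ⊆ Ioc c (z (n - k)) := Ioc_subset_Ioc_right hv
  have hg : ∀ x, x ≠ c → update (f^[n]) c u x = f^[n] x := fun x hx => update_of_ne hx _ _
  have hgL : EqOn (f^[n]) (update (f^[n]) c u) (Ico u c) := fun x hx => (hg x hx.2.ne).symm
  have hgR : EqOn (f^[n]) (update (f^[n]) c u) (Ioc c v) := fun x hx => (hg x hx.1.ne').symm
  obtain ⟨r, hr, hEl, hEr⟩ := hz.exists_expandsOn_iterate hf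
  have h0 : 0 < r := by linarith
  have hlim_left : Tendsto (f^[n]) (𝓝[<] c) (𝓝 v) := hz.tendsto_left hf
  have hlim_right : Tendsto (f^[n]) (𝓝[>] c) (𝓝 u) := hz.tendsto_right hf
  refine
    { one_lt_l := by omega
      one_lt_r := by omega
      u_nonneg := hu0
      u_lt_c := huc
      c_lt_v := hcv
      v_le_one := hv1.le
      proper := .inr hv1
      eq_left := fun x hx _ => hg x hx.2.ne
      eq_right := fun x hx _ => hg x hx.1.ne'
      lim_left_pt := fun x hx => ?_
      lim_right_pt := fun x hx => ?_
      lim_c_left := hlim_left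
      lim_c_right := hlim_right
      lorenz :=
        { a_lt_c := huc
          c_lt_b := hcv
          mapsTo := fun x hx => ?_
          mono_left := ((hEl.mono hL).strictMonoOn h0).congr hgL
          mono_right := ((hEr.mono hR).strictMonoOn h0).congr hgR
          cont_left := ((hz.continuousOn_left hf).mono hL).congr hgL.symm
          cont_right := ((hz.continuousOn_right hf).mono hR).congr hgR.symm
          lim_left := hlim_left.congr' <|
            eventually_mem_nhdsWithin.mono fun x hx => (hg x (ne_of_lt hx)).symm
          lim_right := hlim_right.congr' <|
            eventually_mem_nhdsWithin.mono fun x hx => (hg x (ne_of_gt hx)).symm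
          expanding := ?_ } }
  · rw [hg x hx.2.ne, ← nhdsWithin_Ioo_eq_nhdsGT hx.2]
    exact ((hz.continuousOn_left hf) x (hL hx)).mono_left
      (nhdsWithin_mono _ fun y hy => ⟨(hL hx).1.trans hy.1.le, hy.2⟩)
  · rw [hg x hx.1.ne', ← nhdsWithin_Ioo_eq_nhdsLT hx.1]
    exact ((hz.continuousOn_right hf) x (hR hx)).mono_left
      (nhdsWithin_mono _ fun y hy => ⟨hy.1, hy.2.le.trans (hR hx).2⟩)
  · rcases lt_trichotomy x c with h | rfl | h
    · have hx' := hL ⟨hx.1, h⟩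
      rw [hg x h.ne]
      exact ⟨hx.1.trans (hz.le_iterate_of_mem_left hf hx'),
        (hz.iterate_lt_of_mem_left hf hx').le⟩
    · rw [update_self]
      exact ⟨le_rfl, (huc.trans hcv).le⟩
    · have hx' := hR ⟨h, hx.2⟩
      rw [hg x h.ne']
      exact ⟨(hz.lt_iterate_of_mem_right hf hx').le,
        (hz.iterate_le_of_mem_right hf hx').trans hx.2⟩
  · obtain ⟨F, hF, s, hs, hd⟩ := hf.iterate_expanding (n := n) (by omega)
    refine ⟨insert c F, hF.insert c, s, hs, fun x hx => ?_⟩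
    have hxc : x ≠ c := fun h => hx.2 (.inl h)
    obtain ⟨d, hd, hsd⟩ :=
      hd x ⟨⟨hu0.trans hx.1.1, hx.1.2.trans hv1.le⟩, fun h => hx.2 (.inr h)⟩
    refine ⟨d, (hd.mono (Icc_subset_Icc hu0 hv1.le)).congr_of_eventuallyEq ?_ (hg x hxc), hsd⟩
    exact nhdsWithin_le_nhds ((isOpen_ne.eventually_mem hxc).mono hg)

end IsPrimaryCycle

/-- A primary `n(k)`-cycle gives rise to the renormalization
`g = (f^n, f^n)` on `[u,v]` where `u = f^[n-1] 0`, `v = f^[n-1] 1`. -/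
theorem primary_cycle_gives_renormalization
    (f : ℝ → ℝ) (c : ℝ) (n k : ℕ) (z : ℕ → ℝ)
    (hf : IsExpandingLorenz f c) (hz : IsPrimaryCycle f c n k z) :
    (∀ i < n - 1, f^[i] (0:ℝ) ≠ c ∧ f^[i] (1:ℝ) ≠ c) ∧
    (z (n - k - 1) ≤ f^[n-1] (0:ℝ) ∧ f^[n-1] (0:ℝ) < c ∧
      c < f^[n-1] (1:ℝ) ∧ f^[n-1] (1:ℝ) ≤ z (n - k)) ∧
    (∀ x ∈ Set.Ioo (f^[n-1] (0:ℝ)) c ∪ Set.Ioo c (f^[n-1] (1:ℝ)), ∀ i < n, f^[i] x ≠ c) ∧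
    StrictMonoOn (f^[n]) (Set.Ioo (f^[n-1] (0:ℝ)) c) ∧
    ContinuousOn (f^[n]) (Set.Ioo (f^[n-1] (0:ℝ)) c) ∧
    StrictMonoOn (f^[n]) (Set.Ioo c (f^[n-1] (1:ℝ))) ∧
    ContinuousOn (f^[n]) (Set.Ioo c (f^[n-1] (1:ℝ))) ∧
    Filter.Tendsto (f^[n]) (nhdsWithin c (Set.Iio c)) (nhds (f^[n-1] (1:ℝ))) ∧
    Filter.Tendsto (f^[n]) (nhdsWithin c (Set.Ioi c)) (nhds (f^[n-1] (0:ℝ))) ∧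
    f^[n] '' Set.Ioo (f^[n-1] (0:ℝ)) c ⊆ Set.Ico (f^[n-1] (0:ℝ)) (f^[n-1] (1:ℝ)) ∧
    f^[n] '' Set.Ioo c (f^[n-1] (1:ℝ)) ⊆ Set.Ioc (f^[n-1] (0:ℝ)) (f^[n-1] (1:ℝ)) ∧
    ∃ g : ℝ → ℝ, IsRenormalization f c n n (f^[n-1] (0:ℝ)) (f^[n-1] (1:ℝ)) g := by
  have hu := (hz.mem_gap_left hf).1
  have hv := (hz.mem_gap_right hf).2
  have hL : Ioo (f^[n - 1] 0) c ⊆ Ico (z (n - k - 1)) c := fun x hx => ⟨hu.trans hx.1.le, hx.2⟩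
  have hR : Ioo c (f^[n - 1] 1) ⊆ Ioc c (z (n - k)) := fun x hx => ⟨hx.1, hx.2.le.trans hv⟩
  obtain ⟨r, hr, hEl, hEr⟩ := hz.exists_expandsOn_iterate hf
  have h0 : 0 < r := by linarith
  refine ⟨fun i hi => ⟨hz.iterate_zero_ne hf hi, hz.iterate_one_ne hf hi⟩,
    ⟨hu, hz.iterate_zero_lt hf, hz.lt_iterate_one hf, hv⟩,
    fun x hx i hi => hz.iterate_ne_of_mem hf (union_subset_union hL hR hx) hi,
    (hEl.mono hL).strictMonoOn h0, (hz.continuousOn_left hf).mono hL,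
    (hEr.mono hR).strictMonoOn h0, (hz.continuousOn_right hf).mono hR,
    hz.tendsto_left hf, hz.tendsto_right hf, ?_, ?_, _, hz.isRenormalization hf⟩
  · rintro _ ⟨x, hx, rfl⟩
    exact ⟨hx.1.le.trans (hz.le_iterate_of_mem_left hf (hL hx)),
      hz.iterate_lt_of_mem_left hf (hL hx)⟩
  · rintro _ ⟨x, hx, rfl⟩
    exact ⟨hz.lt_iterate_of_mem_right hf (hR hx),
      (hz.iterate_le_of_mem_right hf (hR hx)).trans hx.2.le⟩
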